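/- Lower bounds on the closest reachable point on the −x-axis: Let σ be a turn sequence with l L's and r R's, l − r ≥ 0, and let C be any chain realizing σ whose endpoint is (−a, 0) with a > 0. If l − r ≡ 0 or 1 (mod 4), then a ≥ |⌊(l − r + 2)/4⌋ − 1| + 1. If l − r ≡ 2 (mod 4), then a ≥ |⌊(l − r + 2)/4⌋ − 2| + 2 when the last turn σₙ = L, and a ≥ ⌊(l − r + 2)/4⌋ + 1 when σₙ = R. If l − r ≡ 3 (mod 4), then a ≥ ⌊(l − r + 2)/4⌋. -/

import Mathlib

/-- A turn: left (`L`) or right (`R`). -/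
inductive Turn : Type
  | L : Turn
  | R : Turn
  deriving DecidableEq

/-- Rotation of a direction vector by 90° counterclockwise. -/
def rotCCW (d : ℤ × ℤ) : ℤ × ℤ := (-d.2, d.1)

/-- Rotation of a direction vector by 90° clockwise. -/
def rotCW (d : ℤ × ℤ) : ℤ × ℤ := (d.2, -d.1)

/-- Unit direction of the axis-parallel segment from `u` to `v`. -/
def unitDir (u v : ℤ × ℤ) : ℤ × ℤ := ((v.1 - u.1).sign, (v.2 - u.2).sign)

/-- The set of integer points on the axis-parallel closed segment from `u` to `v`. -/
def segSet (u v : ℤ × ℤ) : Set (ℤ × ℤ) :=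
  {q | min u.1 v.1 ≤ q.1 ∧ q.1 ≤ max u.1 v.1 ∧ min u.2 v.2 ≤ q.2 ∧ q.2 ≤ max u.2 v.2}

/-- A simple rectilinear chain realizing the turn sequence `σ = σ₁⋯σₙ` (as a list,
`σ.get ⟨i, _⟩` is the `(i+1)`-st turn `σ_{i+1}`).  It consists of the points
`pts 0, …, pts (n+1)` with `pts 0 = (0,0)`; consecutive points span nondegenerate
axis-parallel segments, the first segment heads east, the chain turns left (CCW) or
right (CW) at each bend as prescribed by `σ`, and the chain is simple. -/
structure Chain (σ : List Turn) where
  pts : ℕ → ℤ × ℤ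
  start_eq : pts 0 = (0, 0)
  first_seg : ∃ t : ℤ, 0 < t ∧ pts 1 = (t, 0)
  axis_parallel : ∀ i ≤ σ.length,
    ((pts (i + 1)).1 = (pts i).1 ∧ (pts (i + 1)).2 ≠ (pts i).2) ∨
    ((pts (i + 1)).2 = (pts i).2 ∧ (pts (i + 1)).1 ≠ (pts i).1)
  turns : ∀ i, ∀ h : i < σ.length,
    unitDir (pts (i + 1)) (pts (i + 2)) =
      (if σ.get ⟨i, h⟩ = Turn.L then rotCCW else rotCW) (unitDir (pts i) (pts (i + 1)))
  simple_adj : ∀ i, i + 1 ≤ σ.length →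
    segSet (pts i) (pts (i + 1)) ∩ segSet (pts (i + 1)) (pts (i + 2)) = {pts (i + 1)}
  simple_nonadj : ∀ i j, i + 1 < j → j ≤ σ.length →
    segSet (pts i) (pts (i + 1)) ∩ segSet (pts j) (pts (j + 1)) = ∅

/-- `A(σ)`: the set of points reachable by the turn sequence `σ`. -/
def ReachSet (σ : List Turn) : Set (ℤ × ℤ) :=
  {q | ∃ C : Chain σ, C.pts (σ.length + 1) = q}

/-- The halfplane `V⁺(p)` (requires `p.1 ≠ 0` to be meaningful). -/
def Vplus (p : ℤ × ℤ) : Set (ℤ × ℤ) :=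
  {q | ∃ i j : ℤ, 0 ≤ i ∧ q = (p.1 + p.1.sign * i, j)}

/-- The halfplane `H⁺(p)` (requires `p.2 ≠ 0` to be meaningful). -/
def Hplus (p : ℤ × ℤ) : Set (ℤ × ℤ) :=
  {q | ∃ i j : ℤ, 0 ≤ j ∧ q = (i, p.2 + p.2.sign * j)}

/-- The quadrant `Q⁺(p)`. -/
def Qplus (p : ℤ × ℤ) : Set (ℤ × ℤ) := Vplus p ∩ Hplus p

/-- A staircase: consecutive turns always differ. -/
def IsStaircase (σ : List Turn) : Prop := σ.Chain' (· ≠ ·)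

/-- The prefix number `δᵢ`: number of `L`s minus number of `R`s among the first `i` turns. -/
def delta (σ : List Turn) (i : ℕ) : ℤ :=
  ((σ.take i).count Turn.L : ℤ) - ((σ.take i).count Turn.R : ℤ)

/-- The excess number `l - r` of a turn sequence. -/
def excess (σ : List Turn) : ℤ := (σ.count Turn.L : ℤ) - (σ.count Turn.R : ℤ)

/-- `σ` has a hook (two equal consecutive turns, at 1-based positions `k+1, k+2`)
whose prefix number is `≡ d (mod 4)`: `d = 0, 1, 2, 3` for right, up, left, down hooks. -/
def HasHook (σ : List Turn) (d : ℤ) : Prop :=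
  ∃ k, ∃ h : k + 1 < σ.length,
    σ.get ⟨k, by omega⟩ = σ.get ⟨k + 1, h⟩ ∧ delta σ (k + 1) % 4 = d

/-- `σ` has some hook, i.e. two equal consecutive turns. -/
def HasAnyHook (σ : List Turn) : Prop :=
  ∃ k, ∃ h : k + 1 < σ.length, σ.get ⟨k, by omega⟩ = σ.get ⟨k + 1, h⟩

/-- A set `S ⊆ ℤ²` is connected: any two points of `S` are joined by a path inside `S`
whose consecutive points are at `L¹`-distance `1`. -/
def GridConnected (S : Set (ℤ × ℤ)) : Prop :=
  ∀ p ∈ S, ∀ q ∈ S, ∃ (n : ℕ) (f : ℕ → ℤ × ℤ),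
    f 0 = p ∧ f n = q ∧ (∀ i ≤ n, f i ∈ S) ∧
    ∀ i < n, |(f (i + 1)).1 - (f i).1| + |(f (i + 1)).2 - (f i).2| = 1

/-- `q` lies on the boundary of the smallest axis-parallel bounding box of the chain `C`
(for `q` a point of the chain: it attains an extreme coordinate). -/
def OnBBoxBoundary (σ : List Turn) (C : Chain σ) (q : ℤ × ℤ) : Prop :=
  (∀ i ≤ σ.length + 1, q.1 ≤ (C.pts i).1) ∨ (∀ i ≤ σ.length + 1, (C.pts i).1 ≤ q.1) ∨
  (∀ i ≤ σ.length + 1, q.2 ≤ (C.pts i).2) ∨ (∀ i ≤ σ.length + 1, (C.pts i).2 ≤ q.2)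

/-- The last segment of the chain `C` is entirely contained in one side of the smallest
axis-parallel bounding box of `C`. -/
def LastSegOnSide (σ : List Turn) (C : Chain σ) : Prop :=
  ((C.pts σ.length).1 = (C.pts (σ.length + 1)).1 ∧
     ∀ i ≤ σ.length + 1, (C.pts σ.length).1 ≤ (C.pts i).1) ∨
  ((C.pts σ.length).1 = (C.pts (σ.length + 1)).1 ∧
     ∀ i ≤ σ.length + 1, (C.pts i).1 ≤ (C.pts σ.length).1) ∨
  ((C.pts σ.length).2 = (C.pts (σ.length + 1)).2 ∧
     ∀ i ≤ σ.length + 1, (C.pts σ.length).2 ≤ (C.pts i).2) ∨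
  ((C.pts σ.length).2 = (C.pts (σ.length + 1)).2 ∧
     ∀ i ≤ σ.length + 1, (C.pts i).2 ≤ (C.pts σ.length).2)

/-- The turn `σₘ` (1-based indexing). -/
def turnAt (σ : List Turn) (m : ℕ) : Turn := σ.getD (m - 1) Turn.L

/-- The suffix `σ_k ⋯ σ_n` contains no hook and all its prefix numbers `δᵢ`,
`k - 1 ≤ i ≤ n`, are `≡ 1` or `2 (mod 4)` (the combinatorial description of a
NW-staircase containing the endpoint). -/
def GoodSuffix (σ : List Turn) (k : ℕ) : Prop :=
  1 ≤ k ∧ k ≤ σ.length ∧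
  (∀ m : ℕ, k ≤ m → m < σ.length → turnAt σ m ≠ turnAt σ (m + 1)) ∧
  (∀ i : ℕ, k - 1 ≤ i → i ≤ σ.length → delta σ i % 4 = 1 ∨ delta σ i % 4 = 2)

open Classical in
/-- `₋ₓm₊ᵧᵖ(σ)`: taking the longest good suffix (i.e. the least `k` with
`GoodSuffix σ k`), the number of indices `i` with `k - 1 ≤ i ≤ n` and
`δᵢ ≡ 1 (mod 4)`; `0` if no good suffix exists. -/
noncomputable def mNWp (σ : List Turn) : ℕ :=
  if ∃ k, GoodSuffix σ k then
    Nat.card {i : ℕ // sInf {k | GoodSuffix σ k} - 1 ≤ i ∧ i ≤ σ.length ∧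
      delta σ i % 4 = 1}
  else 0

/-- The number of vertical segments of the chain `C` meeting the closed horizontal
segment from the origin to `(a, 0)`. -/
def verticalCrossCount (σ : List Turn) (C : Chain σ) (a : ℤ) : ℕ :=
  ((Finset.range (σ.length + 1)).filter fun i =>
    (C.pts i).1 = (C.pts (i + 1)).1 ∧
    0 ≤ (C.pts i).1 ∧ (C.pts i).1 ≤ a ∧
    min (C.pts i).2 (C.pts (i + 1)).2 ≤ 0 ∧ 0 ≤ max (C.pts i).2 (C.pts (i + 1)).2).card

/-- The unit direction of the `(i+1)`-st segment of the chain `C`. -/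
def dirOf (σ : List Turn) (C : Chain σ) (i : ℕ) : ℤ × ℤ := unitDir (C.pts i) (C.pts (i + 1))

/-- `z₁mz₂ᵒ(C)`: the number of `z₂`-segments in the maximal `(z₁,z₂)`-staircase subchain
of `C` containing the origin (the longest prefix of segments directed `z₁` or `z₂`);
`0` if no such subchain exists. -/
noncomputable def stairCountO (σ : List Turn) (C : Chain σ) (z₁ z₂ : ℤ × ℤ) : ℕ :=
  Nat.card {i : ℕ // i ≤ σ.length ∧ dirOf σ C i = z₂ ∧
    ∀ j ≤ i, dirOf σ C j = z₁ ∨ dirOf σ C j = z₂}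

/-- `z₁mz₂ᵖ(C)`: the number of `z₂`-segments in the maximal `(z₁,z₂)`-staircase subchain
of `C` containing the endpoint (the longest suffix of segments directed `z₁` or `z₂`);
`0` if no such subchain exists. -/
noncomputable def stairCountP (σ : List Turn) (C : Chain σ) (z₁ z₂ : ℤ × ℤ) : ℕ :=
  Nat.card {i : ℕ // i ≤ σ.length ∧ dirOf σ C i = z₂ ∧
    ∀ j, i ≤ j → j ≤ σ.length → dirOf σ C j = z₁ ∨ dirOf σ C j = z₂}

/-! ### Signed crossings of a ray by secants -/

/-- Signed crossing number of the axis-parallel move from `u` to `v` with the half-line that runs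
just below the positive `x`-axis; upward crossings count positively. -/
def rayCross (u v : ℤ × ℤ) : ℤ :=
  (if 0 < u.1 then 1 else 0) * ((if 0 ≤ v.2 then 1 else 0) - (if 0 ≤ u.2 then 1 else 0))

/-- Signed ray crossings of the secant while it moves from the edge `ab` to the edge `bc`. -/
def cornerCross (a b c : ℤ × ℤ) : ℤ :=
  rayCross (b - a) (c - a) + rayCross (c - a) (c - b)

/-- Signed ray crossings along the boundary of the rectangle of secants from a point of the
edge `ab` to a point of the edge `cd`. -/
def edgeDefect (a b c d : ℤ × ℤ) : ℤ :=
  rayCross (c - a) (d - a) + rayCross (d - a) (d - b)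
    - rayCross (c - a) (c - b) - rayCross (c - b) (d - b)

/-- Discrete version of Hopf's secant homotopy. -/
lemma sum_cornerCross (q : ℕ → ℤ × ℤ) (T : ℕ) :
    ∑ i ∈ Finset.range T, cornerCross (q i) (q (i + 1)) (q (i + 2)) =
      ∑ j ∈ Finset.range T, rayCross (q (j + 1) - q 0) (q (j + 2) - q 0)
      + ∑ i ∈ Finset.range T, rayCross (q (T + 1) - q i) (q (T + 1) - q (i + 1))
      - ∑ j ∈ Finset.range T, ∑ i ∈ Finset.range j,
          edgeDefect (q i) (q (i + 1)) (q (j + 1)) (q (j + 2)) := by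
  induction T with
  | zero => simp
  | succ T ih =>
    have htel := Finset.sum_range_sub'
      (fun i => rayCross (q (T + 1) - q i) (q (T + 2) - q i)) T
    rw [Finset.sum_range_succ, ih, Finset.sum_range_succ _ T, Finset.sum_range_succ _ T,
      Finset.sum_range_succ _ T]
    simp only [edgeDefect, cornerCross, Finset.sum_add_distrib, Finset.sum_sub_distrib] at *
    linarith

lemma edgeDefect_abs_le_one {a b c d : ℤ × ℤ} (hab : b.1 = a.1 ∨ b.2 = a.2)
    (hcd : d.1 = c.1 ∨ d.2 = c.2) : |edgeDefect a b c d| ≤ 1 := by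
  rcases hab with hab | hab <;> rcases hcd with hcd | hcd <;>
    simp only [edgeDefect, rayCross, Prod.fst_sub, Prod.snd_sub, hab, hcd] <;>
    split_ifs <;> norm_num

lemma mem_segSet {u v z : ℤ × ℤ} : z ∈ segSet u v ↔
    min u.1 v.1 ≤ z.1 ∧ z.1 ≤ max u.1 v.1 ∧ min u.2 v.2 ≤ z.2 ∧ z.2 ≤ max u.2 v.2 :=
  Iff.rfl

lemma left_mem_segSet (u v : ℤ × ℤ) : u ∈ segSet u v := by
  simp [segSet]

lemma right_mem_segSet (u v : ℤ × ℤ) : v ∈ segSet u v := by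
  simp [segSet]

/-- A nonzero defect comes from a horizontal and a vertical edge that cross. -/
lemma edgeDefect_ne_zero {a b c d : ℤ × ℤ} (hab : b.1 = a.1 ∨ b.2 = a.2)
    (hcd : d.1 = c.1 ∨ d.2 = c.2) (h : edgeDefect a b c d ≠ 0) :
    (b.1 = a.1 ∧ d.2 = c.2 ∧ (a.1, c.2) ∈ segSet a b ∧ (a.1, c.2) ∈ segSet c d) ∨
    (b.2 = a.2 ∧ d.1 = c.1 ∧ (c.1, a.2) ∈ segSet a b ∧ (c.1, a.2) ∈ segSet c d) := by
  rcases hab with hab | hab <;> rcases hcd with hcd | hcd <;>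
    simp only [edgeDefect, rayCross, Prod.fst_sub, Prod.snd_sub, hab, hcd] at h
  · exact absurd (by ring) h
  · left
    refine ⟨hab, hcd, ?_, ?_⟩ <;> simp only [mem_segSet, hab, hcd] <;>
      split_ifs at h <;> omega
  · right
    refine ⟨hab, hcd, ?_, ?_⟩ <;> simp only [mem_segSet, hab, hcd] <;>
      split_ifs at h <;> omega
  · exact absurd (by ring) h

lemma cornerCross_sub_edgeDefect_ccw {a b c : ℤ × ℤ} (h1 : a.1 = b.1) (h2 : b.2 < a.2)
    (h3 : c.2 = b.2) (h4 : b.1 < c.1) : cornerCross a b c - edgeDefect b c a b = 1 := by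
  simp [cornerCross, edgeDefect, rayCross, h1, h3, h4, h2.not_ge, h4.not_gt, h2.le]

lemma cornerCross_sub_edgeDefect_cw {a b c : ℤ × ℤ} (h1 : a.2 = b.2) (h2 : b.1 < a.1)
    (h3 : c.1 = b.1) (h4 : b.2 < c.2) : cornerCross a b c - edgeDefect b c a b = -1 := by
  simp [cornerCross, edgeDefect, rayCross, h1, h2, h3, h2.not_gt, h4.not_ge, h4.le]

/-- Whitney's formula for a closed rectilinear curve `q 0, …, q T, q (T + 1) = q 0` based at its
lexicographically lowest vertex. -/
lemma sum_cornerCross_closed (q : ℕ → ℤ × ℤ) (T : ℕ) (hT : 2 ≤ T)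
    (h0 : q (T + 1) = q 0) (h1 : q (T + 2) = q 1)
    (hmin : ∀ i, 0 < i → i ≤ T →
      (q 0).2 < (q i).2 ∨ ((q 0).2 = (q i).2 ∧ (q 0).1 < (q i).1))
    (haxis : ∀ i ≤ T, (q (i + 1)).1 = (q i).1 ∨ (q (i + 1)).2 = (q i).2)
    (hcorner : ((q T).1 = (q 0).1 ∧ (q 1).2 = (q 0).2) ∨
      ((q T).2 = (q 0).2 ∧ (q 1).1 = (q 0).1)) :
    ∃ ε : ℤ, (ε = 1 ∨ ε = -1) ∧
      ∑ i ∈ Finset.range (T + 1), cornerCross (q i) (q (i + 1)) (q (i + 2)) =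
        ε - ∑ j ∈ Finset.range T, ∑ i ∈ Finset.range j,
          if i = 0 ∧ j + 1 = T then 0
          else edgeDefect (q i) (q (i + 1)) (q (j + 1)) (q (j + 2)) := by
  have hV : ∑ j ∈ Finset.range T, rayCross (q (j + 1) - q 0) (q (j + 2) - q 0) = 0 := by
    refine Finset.sum_eq_zero fun j hj => ?_
    rw [Finset.mem_range] at hj
    have e1 := hmin (j + 1) (by omega) (by omega)
    have e2 : (q 0).2 ≤ (q (j + 2)).2 := by
      rcases Nat.lt_or_ge (j + 1) T with h | h
      · have := hmin (j + 2) (by omega) (by omega)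
        omega
      · obtain rfl : T = j + 1 := by omega
        rw [h0]
    simp only [rayCross, Prod.snd_sub]
    rw [if_pos (show 0 ≤ (q (j + 2)).2 - (q 0).2 by omega),
      if_pos (show 0 ≤ (q (j + 1)).2 - (q 0).2 by omega)]
    simp
  have hH : ∑ i ∈ Finset.range T, rayCross (q (T + 1) - q i) (q (T + 1) - q (i + 1)) = 0 := by
    refine Finset.sum_eq_zero fun i hi => ?_
    rw [Finset.mem_range] at hi
    rw [h0]
    rcases Nat.eq_zero_or_pos i with rfl | hpos
    · simp [rayCross]
    have e1 := hmin i hpos (by omega)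
    have e2 := hmin (i + 1) (by omega) (by omega)
    have e3 := haxis i (by omega)
    simp only [rayCross, Prod.fst_sub, Prod.snd_sub]
    split_ifs <;> omega
  have hD : ∑ j ∈ Finset.range T, ∑ i ∈ Finset.range j,
        edgeDefect (q i) (q (i + 1)) (q (j + 1)) (q (j + 2)) =
      edgeDefect (q 0) (q 1) (q T) (q (T + 1)) +
      ∑ j ∈ Finset.range T, ∑ i ∈ Finset.range j,
          if i = 0 ∧ j + 1 = T then 0
          else edgeDefect (q i) (q (i + 1)) (q (j + 1)) (q (j + 2)) := by
    obtain ⟨k, rfl⟩ : ∃ k, T = k + 2 := ⟨T - 2, by omega⟩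
    rw [Finset.sum_range_succ, Finset.sum_range_succ _ (k + 1)]
    have : ∑ j ∈ Finset.range (k + 1), ∑ i ∈ Finset.range j,
          (if i = 0 ∧ j + 1 = k + 2 then 0
          else edgeDefect (q i) (q (i + 1)) (q (j + 1)) (q (j + 2))) =
        ∑ j ∈ Finset.range (k + 1), ∑ i ∈ Finset.range j,
          edgeDefect (q i) (q (i + 1)) (q (j + 1)) (q (j + 2)) := by
      refine Finset.sum_congr rfl fun j hj => Finset.sum_congr rfl fun i _ => ?_
      rw [Finset.mem_range] at hj
      exact if_neg (by omega)
    have hlast (g : ℕ → ℤ) : ∑ i ∈ Finset.range (k + 1), g i =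
        g 0 + ∑ i ∈ Finset.range (k + 1), if i = 0 ∧ k + 1 + 1 = k + 2 then 0 else g i := by
      simp [Finset.sum_range_succ', add_comm (g 0)]
    rw [this, hlast fun i => edgeDefect (q i) (q (i + 1)) (q (k + 1 + 1)) (q (k + 1 + 2))]
    ring
  have hsum := sum_cornerCross q T
  rw [hV, hH, hD, h0] at hsum
  have e1 := hmin 1 (by omega) (by omega)
  have e2 := hmin T (by omega) le_rfl
  refine ⟨cornerCross (q T) (q 0) (q 1) - edgeDefect (q 0) (q 1) (q T) (q 0), ?_, ?_⟩
  · rcases hcorner with ⟨c1, c2⟩ | ⟨c1, c2⟩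
    · left
      exact cornerCross_sub_edgeDefect_ccw c1 (by omega) c2 (by omega)
    · right
      exact cornerCross_sub_edgeDefect_cw c1 (by omega) c2 (by omega)
  · rw [Finset.sum_range_succ, hsum, h0, h1]
    ring

lemma sum_pairs_le (X : ℕ → ℤ) (hX : ∀ k, 0 ≤ X k) (s T : ℕ) :
    ∑ j ∈ Finset.range T, ∑ i ∈ Finset.range j,
        ((if i = s then X (j + 1) else 0) + (if j + 1 = s then X i else 0)) ≤
      if s ≤ T then ∑ k ∈ Finset.range (T + 1), X k else 0 := by
  induction T with
  | zero => split_ifs <;> simp [hX]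
  | succ T ih =>
    rw [Finset.sum_range_succ, Finset.sum_add_distrib, Finset.sum_ite_eq']
    have hnn := hX T
    have hnn' := hX (T + 1)
    have hsum : 0 ≤ ∑ k ∈ Finset.range T, X k := Finset.sum_nonneg fun k _ => hX k
    have e1 : ∑ k ∈ Finset.range (T + 1), X k = ∑ k ∈ Finset.range T, X k + X T :=
      Finset.sum_range_succ _ _
    have e2 := Finset.sum_range_succ X (T + 1)
    by_cases h : T + 1 = s
    · subst h
      simp only [if_true, Finset.mem_range] at *
      split_ifs at * <;> omega
    · simp only [h, if_false, Finset.mem_range, Finset.sum_const_zero] at *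
      split_ifs at * <;> omega

lemma sum_range_add_of_periodic (f : ℕ → ℤ) (M : ℕ) (hf : ∀ i, f (i + M) = f i) (b : ℕ) :
    ∑ i ∈ Finset.range M, f (b + i) = ∑ i ∈ Finset.range M, f i := by
  induction b with
  | zero => simp
  | succ b ih =>
    have e := Finset.sum_range_succ (fun i => f (b + i)) M
    rw [Finset.sum_range_succ', hf b] at e
    simp only [add_zero] at e
    rw [← ih, ← add_right_cancel e]
    exact Finset.sum_congr rfl fun i _ => by congr 1; ring

/-! ### Directions along a chain -/

/-- The unit direction obtained from east after `k` quarter turns counterclockwise. -/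
def quarterDir (k : ℤ) : ℤ × ℤ :=
  if k % 4 = 0 then (1, 0) else if k % 4 = 1 then (0, 1) else if k % 4 = 2 then (-1, 0) else (0, -1)

lemma rotCCW_quarterDir (k : ℤ) : rotCCW (quarterDir k) = quarterDir (k + 1) := by
  unfold quarterDir rotCCW
  split_ifs <;> first | omega | rfl

lemma rotCW_quarterDir (k : ℤ) : rotCW (quarterDir k) = quarterDir (k - 1) := by
  unfold quarterDir rotCW
  split_ifs <;> first | omega | rfl

lemma unitDir_eq_quarterDir_iff {u v : ℤ × ℤ} {k : ℤ} :
    unitDir u v = quarterDir k ↔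
      (k % 4 = 0 ∧ u.1 < v.1 ∧ u.2 = v.2) ∨ (k % 4 = 1 ∧ u.1 = v.1 ∧ u.2 < v.2) ∨
      (k % 4 = 2 ∧ v.1 < u.1 ∧ u.2 = v.2) ∨ (k % 4 = 3 ∧ u.1 = v.1 ∧ v.2 < u.2) := by
  unfold unitDir quarterDir
  split_ifs <;>
    simp only [Prod.mk.injEq, Int.sign_eq_one_iff_pos, Int.sign_eq_neg_one_iff_neg,
      Int.sign_eq_zero_iff_zero] <;> omega

lemma cornerCross_eq_div_sub_div {a b c : ℤ × ℤ} {k k' : ℤ} (hab : unitDir a b = quarterDir k)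
    (hbc : unitDir b c = quarterDir k') (hk : k' = k + 1 ∨ k' = k - 1) :
    cornerCross a b c = k' / 4 - k / 4 := by
  rw [unitDir_eq_quarterDir_iff] at hab hbc
  simp only [cornerCross, rayCross, Prod.fst_sub, Prod.snd_sub]
  split_ifs <;> omega

lemma delta_succ (σ : List Turn) (i : ℕ) (h : i < σ.length) :
    delta σ (i + 1) = if σ.get ⟨i, h⟩ = Turn.L then delta σ i + 1 else delta σ i - 1 := by
  unfold delta
  rw [← List.take_concat_get' σ i h, List.count_append, List.count_append, List.get_eq_getElem]
  cases σ[i] <;> simp <;> ring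

lemma delta_length (σ : List Turn) : delta σ σ.length = excess σ := by
  simp [delta, excess]

namespace Chain

variable {σ : List Turn} (C : Chain σ)

lemma unitDir_eq {i : ℕ} (hi : i ≤ σ.length) :
    unitDir (C.pts i) (C.pts (i + 1)) = quarterDir (delta σ i) := by
  induction i with
  | zero =>
    obtain ⟨t, ht, h1⟩ := C.first_seg
    rw [unitDir_eq_quarterDir_iff, C.start_eq, h1]
    simp [delta, ht]
  | succ i ih =>
    rw [C.turns i hi, ih (by omega), delta_succ σ i hi]
    split_ifs
    · exact rotCCW_quarterDir _
    · exact rotCW_quarterDir _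

lemma sum_cornerCross_eq {i : ℕ} (hi : i ≤ σ.length) :
    ∑ j ∈ Finset.range i, cornerCross (C.pts j) (C.pts (j + 1)) (C.pts (j + 2)) =
      delta σ i / 4 := by
  induction i with
  | zero => simp [delta]
  | succ i ih =>
    rw [Finset.sum_range_succ, ih (by omega),
      cornerCross_eq_div_sub_div (C.unitDir_eq (i := i) (by omega)) (C.unitDir_eq hi)]
    · ring
    · rw [delta_succ σ i hi]
      split_ifs <;> simp

lemma perp {i : ℕ} (hi : i < σ.length) :
    ((C.pts i).1 = (C.pts (i + 1)).1 ∧ (C.pts (i + 1)).2 = (C.pts (i + 2)).2) ∨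
    ((C.pts i).2 = (C.pts (i + 1)).2 ∧ (C.pts (i + 1)).1 = (C.pts (i + 2)).1) := by
  have h1 := C.unitDir_eq (i := i) (by omega)
  have h2 : unitDir (C.pts (i + 1)) (C.pts (i + 2)) = _ := C.unitDir_eq (i := i + 1) hi
  have h3 := delta_succ σ i hi
  rw [unitDir_eq_quarterDir_iff] at h1 h2
  split_ifs at h3 <;> omega

lemma pts_succ_ne {i : ℕ} (hi : i ≤ σ.length) : C.pts (i + 1) ≠ C.pts i := by
  intro h
  have := C.axis_parallel i hi
  simp [h] at this

lemma disjoint_segSet {i j : ℕ} (hij : i + 1 < j) (hj : j ≤ σ.length) {z : ℤ × ℤ}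
    (hi : z ∈ segSet (C.pts i) (C.pts (i + 1))) (hz : z ∈ segSet (C.pts j) (C.pts (j + 1))) :
    False :=
  (C.simple_nonadj i j hij hj).subset ⟨hi, hz⟩

/-- A vertex of a chain lies only on the edges it is an endpoint of. -/
lemma pts_mem_segSet {k j : ℕ} (hk : k ≤ σ.length + 1) (hj : j ≤ σ.length)
    (h : C.pts k ∈ segSet (C.pts j) (C.pts (j + 1))) : k = j ∨ k = j + 1 := by
  by_contra! hne
  rcases lt_or_gt_of_ne hne.1 with hlt | hlt
  · rcases Nat.lt_or_ge (k + 1) j with h2 | h2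
    · exact C.disjoint_segSet h2 hj (left_mem_segSet _ _) h
    · obtain rfl : j = k + 1 := by omega
      have := (C.simple_adj k hj).subset ⟨left_mem_segSet _ _, h⟩
      exact C.pts_succ_ne (by omega) this.symm
  · obtain ⟨m, rfl⟩ : ∃ m, k = m + 1 := ⟨k - 1, by omega⟩
    rcases Nat.lt_or_ge (j + 1) m with h2 | h2
    · exact C.disjoint_segSet h2 (by omega) h (right_mem_segSet _ _)
    · obtain rfl : m = j + 1 := by omega
      have := (C.simple_adj j (by omega)).subset ⟨h, right_mem_segSet _ _⟩
      exact C.pts_succ_ne (by omega) this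

lemma pts_injOn {i j : ℕ} (hi : i ≤ σ.length + 1) (hj : j ≤ σ.length + 1)
    (h : C.pts i = C.pts j) : i = j := by
  by_contra hne
  wlog hlt : i < j generalizing i j
  · exact this hj hi h.symm (Ne.symm hne) (by omega)
  obtain ⟨m, rfl⟩ : ∃ m, j = m + 1 := ⟨j - 1, by omega⟩
  have h1 := C.pts_mem_segSet hi (j := m) (by omega) (h ▸ right_mem_segSet _ _)
  obtain rfl : i = m := by omega
  exact C.pts_succ_ne (by omega) h.symm

open Classical in
/-- The vertical edges of a chain, other than its first and last edge, that meet the segment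
between `(-a, 0)` and the origin. -/
noncomputable def crossings (a : ℤ) : Finset ℕ :=
  (Finset.range (σ.length + 2)).filter fun k =>
    1 ≤ k ∧ k < σ.length ∧ (C.pts (k + 1)).1 = (C.pts k).1 ∧
    ((C.pts k).1, (0 : ℤ)) ∈ segSet (C.pts k) (C.pts (k + 1)) ∧
    -a ≤ (C.pts k).1 ∧ (C.pts k).1 ≤ 0

lemma card_crossings_lt {a : ℤ} (ha : 0 < a) (hend : C.pts (σ.length + 1) = (-a, 0)) :
    ((C.crossings a).card : ℤ) ≤ a - 1 := by
  have hcard : (C.crossings a).card ≤ (Finset.Ioo (-a) 0).card := by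
    refine Finset.card_le_card_of_injOn (fun k => (C.pts k).1) ?_ ?_
    · intro k hk
      simp only [crossings, Finset.coe_filter, Set.mem_ofPred_eq] at hk
      obtain ⟨-, hk1, hk2, hv, hmem, hx1, hx2⟩ := hk
      simp only [Finset.coe_Ioo, Set.mem_Ioo]
      refine ⟨lt_of_le_of_ne hx1 fun h => ?_, lt_of_le_of_ne hx2 fun h => ?_⟩
      · rw [← h, ← hend] at hmem
        have := C.pts_mem_segSet le_rfl (by omega) hmem
        omega
      · rw [h, ← C.start_eq] at hmem
        have := C.pts_mem_segSet (by omega) (by omega) hmem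
        omega
    · intro k hk k' hk' hkk
      by_contra hne
      wlog hlt : k < k' generalizing k k'
      · exact this hk' hk hkk.symm (Ne.symm hne) (by omega)
      simp only [crossings, Finset.coe_filter, Set.mem_ofPred_eq] at hk hk' hkk
      obtain ⟨-, hk1, hk2, hv, hmem, hx1, hx2⟩ := hk
      obtain ⟨-, hk1', hk2', hv', hmem', hx1', hx2'⟩ := hk'
      rw [← hkk] at hmem'
      rcases Nat.lt_or_ge (k + 1) k' with h | h
      · exact C.disjoint_segSet h (by omega) hmem hmem'
      · obtain rfl : k' = k + 1 := by omega
        have h1 := C.perp hk2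
        have h2 := C.pts_succ_ne (i := k) (by omega)
        have h3 := C.pts_succ_ne (i := k + 1) (by omega)
        simp only [ne_eq, Prod.ext_iff, not_and] at h2 h3
        rcases h1 with h1 | h1
        · exact h3 hv' h1.2.symm
        · exact h2 hv h1.1.symm
  rw [Int.card_Ioo] at hcard
  omega

/-- The vertices of a chain, repeated periodically. -/
def closedPts (i : ℕ) : ℤ × ℤ := C.pts (i % (σ.length + 2))

lemma closedPts_of_lt {i : ℕ} (hi : i < σ.length + 2) : C.closedPts i = C.pts i := by
  rw [closedPts, Nat.mod_eq_of_lt hi]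

lemma closedPts_add (i : ℕ) : C.closedPts (i + (σ.length + 2)) = C.closedPts i := by
  simp [closedPts]

lemma closedPts_succ_of_mod_lt {i k : ℕ} (hk : i % (σ.length + 2) = k) (h : k < σ.length + 1) :
    C.closedPts (i + 1) = C.pts (k + 1) := by
  rw [closedPts, Nat.add_mod, hk, Nat.mod_eq_of_lt (by omega : 1 < σ.length + 2),
    Nat.mod_eq_of_lt (by omega)]

lemma closedPts_succ_of_mod_eq {i : ℕ} (h : i % (σ.length + 2) = σ.length + 1) :
    C.closedPts (i + 1) = C.pts 0 := by
  rw [closedPts, Nat.add_mod, h, Nat.mod_eq_of_lt (by omega : 1 < σ.length + 2), Nat.mod_self]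

lemma sum_cornerCross_closedPts {a : ℤ} (ha : 0 < a) (hn : 0 < σ.length)
    (hend : C.pts (σ.length + 1) = (-a, 0)) (h2 : excess σ % 4 ≠ 2) :
    ∑ i ∈ Finset.range (σ.length + 2),
      cornerCross (C.closedPts i) (C.closedPts (i + 1)) (C.closedPts (i + 2)) =
        (excess σ + 2) / 4 := by
  rw [Finset.sum_range_succ, Finset.sum_range_succ]
  have hsum : ∑ i ∈ Finset.range σ.length,
      cornerCross (C.closedPts i) (C.closedPts (i + 1)) (C.closedPts (i + 2)) =
        excess σ / 4 := by
    rw [← delta_length, ← C.sum_cornerCross_eq le_rfl]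
    refine Finset.sum_congr rfl fun i hi => ?_
    rw [Finset.mem_range] at hi
    rw [C.closedPts_of_lt (by omega), C.closedPts_of_lt (by omega), C.closedPts_of_lt (by omega)]
  have e0 : C.closedPts (σ.length + 2) = (0, 0) := by
    rw [← zero_add (σ.length + 2), C.closedPts_add, C.closedPts_of_lt (by omega), C.start_eq]
  obtain ⟨t, ht, hp1⟩ := C.first_seg
  have e1 : C.closedPts (σ.length + 1 + 2) = (t, 0) := by
    rw [show σ.length + 1 + 2 = 1 + (σ.length + 2) by ring, C.closedPts_add,
      C.closedPts_of_lt (by omega), hp1]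
  have hdir := C.unitDir_eq le_rfl
  rw [delta_length, hend, unitDir_eq_quarterDir_iff] at hdir
  rw [hsum, e1, show σ.length + 1 + 1 = σ.length + 2 by ring, e0,
    C.closedPts_of_lt (by omega), C.closedPts_of_lt (by omega), hend]
  simp only [cornerCross, rayCross, Prod.fst_sub, Prod.snd_sub]
  split_ifs <;> omega

lemma exists_lowest : ∃ b < σ.length + 2, ∀ i < σ.length + 2, i ≠ b →
    (C.pts b).2 < (C.pts i).2 ∨ ((C.pts b).2 = (C.pts i).2 ∧ (C.pts b).1 < (C.pts i).1) := by
  obtain ⟨b, hb, hmin⟩ := Finset.exists_min_image (Finset.range (σ.length + 2))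
    (fun i => toLex ((C.pts i).2, (C.pts i).1)) ⟨0, by simp⟩
  rw [Finset.mem_range] at hb
  refine ⟨b, hb, fun i hi hne => ?_⟩
  have h := hmin i (Finset.mem_range.2 hi)
  rw [Prod.Lex.toLex_le_toLex] at h
  rcases h with h | ⟨h, h'⟩
  · exact Or.inl h
  · refine Or.inr ⟨h, lt_of_le_of_ne h' fun h'' => hne ?_⟩
    exact (C.pts_injOn (by omega) (by omega) (Prod.ext h'' h)).symm

lemma closedPts_axis {a : ℤ} (hend : C.pts (σ.length + 1) = (-a, 0)) (i : ℕ) :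
    (C.closedPts (i + 1)).1 = (C.closedPts i).1 ∨ (C.closedPts (i + 1)).2 = (C.closedPts i).2 := by
  have hlt := Nat.mod_lt i (show 0 < σ.length + 2 by omega)
  rcases Nat.lt_or_ge (i % (σ.length + 2)) (σ.length + 1) with h | h
  · rw [C.closedPts_succ_of_mod_lt rfl h, closedPts]
    have := C.axis_parallel (i % (σ.length + 2)) (by omega)
    tauto
  · have h' : i % (σ.length + 2) = σ.length + 1 := by omega
    rw [C.closedPts_succ_of_mod_eq h', closedPts, h', hend, C.start_eq]
    simp

lemma abs_edgeDefect_closedPts_le {a : ℤ} (ha : 0 < a) (hend : C.pts (σ.length + 1) = (-a, 0))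
    {i j k l : ℕ} (hk : i % (σ.length + 2) = k) (hl : j % (σ.length + 2) = l)
    (hkl : k + 1 < l ∨ l + 1 < k) (hkl0 : ¬ (k = 0 ∧ l = σ.length + 1))
    (hlk0 : ¬ (l = 0 ∧ k = σ.length + 1)) :
    |edgeDefect (C.closedPts i) (C.closedPts (i + 1)) (C.closedPts j) (C.closedPts (j + 1))| ≤
      (if k = σ.length + 1 then if l ∈ C.crossings a then 1 else 0 else 0) +
      (if l = σ.length + 1 then if k ∈ C.crossings a then 1 else 0 else 0) := by
  have hkn : k < σ.length + 2 := hk ▸ Nat.mod_lt _ (by omega)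
  have hln : l < σ.length + 2 := hl ▸ Nat.mod_lt _ (by omega)
  have hi : C.closedPts i = C.pts k := by rw [closedPts, hk]
  have hj : C.closedPts j = C.pts l := by rw [closedPts, hl]
  have h1 := edgeDefect_abs_le_one (C.closedPts_axis hend i) (C.closedPts_axis hend j)
  by_cases h0 : edgeDefect (C.closedPts i) (C.closedPts (i + 1)) (C.closedPts j)
      (C.closedPts (j + 1)) = 0
  · rw [h0, abs_zero]
    positivity
  have hcross := edgeDefect_ne_zero (C.closedPts_axis hend i) (C.closedPts_axis hend j) h0
  by_cases hks : k = σ.length + 1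
  · have hl' : l < σ.length := by omega
    rw [C.closedPts_succ_of_mod_eq (hk.trans hks), hi, hj,
      C.closedPts_succ_of_mod_lt hl (by omega), hks, hend, C.start_eq] at hcross
    have hmem : l ∈ C.crossings a := by
      simp only [crossings, Finset.mem_filter, Finset.mem_range, mem_segSet] at hcross ⊢
      omega
    rw [if_pos hks, if_pos hmem, if_neg (by omega)]
    simpa using h1
  by_cases hls : l = σ.length + 1
  · have hk' : k < σ.length := by omega
    rw [C.closedPts_succ_of_mod_eq (hl.trans hls), hi, hj,
      C.closedPts_succ_of_mod_lt hk (by omega), hls, hend, C.start_eq] at hcross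
    have hmem : k ∈ C.crossings a := by
      simp only [crossings, Finset.mem_filter, Finset.mem_range, mem_segSet] at hcross ⊢
      omega
    rw [if_neg hks, if_pos hls, if_pos hmem]
    simpa using h1
  rw [hi, hj, C.closedPts_succ_of_mod_lt hk (by omega),
    C.closedPts_succ_of_mod_lt hl (by omega)] at hcross
  exfalso
  rcases hkl with hkl | hkl <;> rcases hcross with ⟨-, -, m1, m2⟩ | ⟨-, -, m1, m2⟩
  · exact C.disjoint_segSet hkl (by omega) m1 m2
  · exact C.disjoint_segSet hkl (by omega) m1 m2
  · exact C.disjoint_segSet hkl (by omega) m2 m1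
  · exact C.disjoint_segSet hkl (by omega) m2 m1

lemma abs_excess_sub_one_le {a : ℤ} (h0 : 0 ≤ excess σ) (ha : 0 < a)
    (hend : C.pts (σ.length + 1) = (-a, 0)) (h2 : excess σ % 4 ≠ 2) :
    |(excess σ + 2) / 4 - 1| + 1 ≤ a := by
  classical
  have hn : 0 < σ.length := by
    by_contra hn
    obtain ⟨t, ht, hp1⟩ := C.first_seg
    rw [show σ.length = 0 by omega, zero_add, hp1, Prod.mk.injEq] at hend
    omega
  obtain ⟨b, hb, hmin⟩ := C.exists_lowest
  have hb0 : b ≠ 0 := by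
    rintro rfl
    have := hmin (σ.length + 1) (by omega) (by omega)
    rw [hend, C.start_eq] at this
    simp only at this
    omega
  have hqT : C.closedPts (b + (σ.length + 1)) = C.pts (b - 1) := by
    rw [show b + (σ.length + 1) = b - 1 + (σ.length + 2) by omega, C.closedPts_add,
      C.closedPts_of_lt (by omega)]
  have hqb : C.closedPts b = C.pts b := C.closedPts_of_lt hb
  have hcorner : ((C.closedPts (b + (σ.length + 1))).1 = (C.closedPts b).1 ∧
        (C.closedPts (b + 1)).2 = (C.closedPts b).2) ∨
      ((C.closedPts (b + (σ.length + 1))).2 = (C.closedPts b).2 ∧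
        (C.closedPts (b + 1)).1 = (C.closedPts b).1) := by
    rw [hqT, hqb]
    rcases Nat.lt_or_ge b (σ.length + 1) with h | h
    · rw [C.closedPts_of_lt (by omega)]
      have := C.perp (i := b - 1) (by omega)
      rw [show b - 1 + 1 = b by omega, show b - 1 + 2 = b + 1 by omega] at this
      omega
    · obtain rfl : b = σ.length + 1 := by omega
      have hlow := hmin σ.length (by omega) (by omega)
      have hdir := C.unitDir_eq le_rfl
      rw [delta_length, unitDir_eq_quarterDir_iff] at hdir
      rw [C.closedPts_succ_of_mod_eq (Nat.mod_eq_of_lt hb), C.start_eq, Nat.add_sub_cancel]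
      rw [hend] at hlow hdir ⊢
      simp only at hlow hdir
      exact Or.inl ⟨by omega, rfl⟩
  obtain ⟨ε, hε, hW⟩ := sum_cornerCross_closed (fun i => C.closedPts (b + i)) (σ.length + 1)
    (by omega) (C.closedPts_add b)
    (by
      show C.closedPts (b + (σ.length + 1 + 2)) = C.closedPts (b + 1)
      rw [← C.closedPts_add (b + 1)]
      congr 1
      ring)
    (by
      intro i hi hiT
      have hmod := Nat.mod_lt (b + i) (show 0 < σ.length + 2 by omega)
      change (C.closedPts b).2 < (C.closedPts (b + i)).2 ∨
        (C.closedPts b).2 = (C.closedPts (b + i)).2 ∧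
        (C.closedPts b).1 < (C.closedPts (b + i)).1
      rw [hqb]
      refine hmin _ hmod fun h => ?_
      rcases Nat.lt_or_ge (b + i) (σ.length + 2) with h' | h'
      · rw [Nat.mod_eq_of_lt h'] at h
        omega
      · rw [Nat.mod_eq_sub_mod h', Nat.mod_eq_of_lt (by omega)] at h
        omega)
    (fun i _ => C.closedPts_axis hend (b + i)) hcorner
  have hrot := sum_range_add_of_periodic
    (fun i => cornerCross (C.closedPts i) (C.closedPts (i + 1)) (C.closedPts (i + 2)))
    (σ.length + 2)
    (fun i => by
      simp only [← C.closedPts_add i, ← C.closedPts_add (i + 1), ← C.closedPts_add (i + 2)]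
      ring_nf) b
  rw [C.sum_cornerCross_closedPts ha hn hend h2] at hrot
  replace hW := hrot.symm.trans hW
  let X : ℕ → ℤ := fun k => if k % (σ.length + 2) ∈ C.crossings a then 1 else 0
  have hX : ∑ k ∈ Finset.range (σ.length + 2), X (b + k) ≤ a - 1 := by
    refine le_trans (le_of_eq ?_) (C.card_crossings_lt ha hend)
    rw [sum_range_add_of_periodic X _ (fun i => by simp [X]) b, Finset.card_eq_sum_ones,
      Nat.cast_sum, ← Finset.sum_filter_of_ne (p := (· ∈ C.crossings a))]
    · refine Finset.sum_congr ?_ fun k hk => ?_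
      · ext k
        simp only [crossings, Finset.mem_filter]
        tauto
      · rw [crossings, Finset.mem_filter, Finset.mem_range] at hk
        simp only [X, Nat.mod_eq_of_lt hk.1]
        simp [crossings, hk]
    · intro k hk hne
      simp only [X, Nat.mod_eq_of_lt (Finset.mem_range.1 hk)] at hne
      by_contra h
      exact hne (if_neg h)
  have hpairs := sum_pairs_le (fun k => X (b + k)) (fun k => by simp only [X]; positivity)
    (σ.length + 1 - b) (σ.length + 1)
  rw [if_pos (by omega)] at hpairs
  have habs : |∑ j ∈ Finset.range (σ.length + 1), ∑ i ∈ Finset.range j,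
      if i = 0 ∧ j + 1 = σ.length + 1 then 0
      else edgeDefect (C.closedPts (b + i)) (C.closedPts (b + (i + 1)))
        (C.closedPts (b + (j + 1))) (C.closedPts (b + (j + 2)))| ≤ a - 1 := by
    refine le_trans ?_ (hpairs.trans hX)
    refine (Finset.abs_sum_le_sum_abs _ _).trans (Finset.sum_le_sum fun j hj => ?_)
    refine (Finset.abs_sum_le_sum_abs _ _).trans (Finset.sum_le_sum fun i hi => ?_)
    rw [Finset.mem_range] at hi hj
    have hmod (m : ℕ) (hm : m < σ.length + 2) : (b + m < σ.length + 2 ∧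
        (b + m) % (σ.length + 2) = b + m) ∨ (σ.length + 2 ≤ b + m ∧
        (b + m) % (σ.length + 2) = b + m - (σ.length + 2)) := by
      rcases Nat.lt_or_ge (b + m) (σ.length + 2) with h | h
      · exact Or.inl ⟨h, Nat.mod_eq_of_lt h⟩
      · exact Or.inr ⟨h, by rw [Nat.mod_eq_sub_mod h, Nat.mod_eq_of_lt (by omega)]⟩
    have hi' := hmod i (by omega)
    have hj' := hmod (j + 1) (by omega)
    by_cases hij : i = 0 ∧ j + 1 = σ.length + 1
    · rw [if_pos hij, abs_zero]
      simp only [X]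
      positivity
    rw [if_neg hij]
    refine (C.abs_edgeDefect_closedPts_le ha hend rfl rfl (by omega) (by omega)
      (by omega)).trans (le_of_eq ?_)
    simp only [X]
    congr 1
    · exact if_congr (by omega) rfl rfl
    · exact if_congr (by omega) rfl rfl
  rw [abs_le] at habs
  have : |(excess σ + 2) / 4 - 1| ≤ a - 1 := by
    rw [abs_le]
    rcases hε with rfl | rfl <;> constructor <;> omega
  linarith

/-- The chain without its last edge. -/
def dropLastEdge {τ : List Turn} {x : Turn} (C : Chain (τ ++ [x])) : Chain τ where
  pts := C.pts
  start_eq := C.start_eq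
  first_seg := C.first_seg
  axis_parallel i hi := C.axis_parallel i (by simp; omega)
  turns i h := by
    rw [C.turns i (by simp; omega)]
    simp [List.getElem_append_left h]
  simple_adj i hi := C.simple_adj i (by simp; omega)
  simple_nonadj i j hij hj := C.simple_nonadj i j hij (by simp; omega)

end Chain

lemma excess_append_singleton (τ : List Turn) (x : Turn) :
    excess (τ ++ [x]) = excess τ + if x = Turn.L then 1 else -1 := by
  cases x <;> simp [excess] <;> ring

lemma Chain.exists_dropLastEdge_end {τ : List Turn} {x : Turn} (C : Chain (τ ++ [x]))
    {a : ℤ} (ha : 0 < a)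
    (hend : C.pts ((τ ++ [x]).length + 1) = (-a, 0)) (h2 : excess (τ ++ [x]) % 4 = 2)
    (hτ : τ ≠ []) : ∃ a', 0 < a' ∧ a' < a ∧ C.dropLastEdge.pts (τ.length + 1) = (-a', 0) := by
  have hlen : (τ ++ [x]).length = τ.length + 1 := by simp
  have hpos := List.length_pos_iff.2 hτ
  have hdir := C.unitDir_eq le_rfl
  rw [delta_length, unitDir_eq_quarterDir_iff, hend, hlen] at hdir
  simp only at hdir
  refine ⟨-(C.pts (τ.length + 1)).1, ?_, by omega, Prod.ext (by simp [dropLastEdge]) ?_⟩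
  · by_contra hle
    have hmem : C.pts 0 ∈ segSet (C.pts (τ.length + 1)) (C.pts (τ.length + 1 + 1)) := by
      rw [hlen] at hend
      rw [hend, C.start_eq, mem_segSet]
      refine ⟨?_, ?_, ?_, ?_⟩ <;> simp only <;> omega
    have := C.pts_mem_segSet (by omega) (by omega) hmem
    omega
  · show (C.pts (τ.length + 1)).2 = 0
    omega

/-- **Lower bounds on the closest reachable point on the `-x`-axis.** -/
theorem lower_bound_x_minus (σ : List Turn) (h0 : 0 ≤ excess σ)
    (C : Chain σ) (a : ℤ) (ha : 0 < a)
    (hend : C.pts (σ.length + 1) = (-a, 0)) :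
    (excess σ % 4 = 0 ∨ excess σ % 4 = 1 → |(excess σ + 2) / 4 - 1| + 1 ≤ a) ∧
    (excess σ % 4 = 2 → σ.getLast? = some Turn.L → |(excess σ + 2) / 4 - 2| + 2 ≤ a) ∧
    (excess σ % 4 = 2 → σ.getLast? = some Turn.R → (excess σ + 2) / 4 + 1 ≤ a) ∧
    (excess σ % 4 = 3 → (excess σ + 2) / 4 ≤ a) := by
  have hlen (y : Turn) (τ : List Turn) (hE : excess (τ ++ [y]) % 4 = 2)
      (h : 0 ≤ excess (τ ++ [y])) : τ ≠ [] := by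
    rintro rfl
    cases y <;> simp [excess] at hE h
  refine ⟨fun h => C.abs_excess_sub_one_le h0 ha hend (by omega), fun h hL => ?_,
    fun h hR => ?_, fun h => ?_⟩
  · obtain ⟨τ, rfl⟩ := List.getLast?_eq_some_iff.1 hL
    obtain ⟨a', ha', hlt, hend'⟩ := C.exists_dropLastEdge_end ha hend h (hlen _ _ h h0)
    have hE := excess_append_singleton τ Turn.L
    rw [if_pos rfl] at hE
    have := C.dropLastEdge.abs_excess_sub_one_le (by omega) ha' hend' (by omega)
    rw [show (excess (τ ++ [Turn.L]) + 2) / 4 - 2 = (excess τ + 2) / 4 - 1 by omega]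
    omega
  · obtain ⟨τ, rfl⟩ := List.getLast?_eq_some_iff.1 hR
    obtain ⟨a', ha', hlt, hend'⟩ := C.exists_dropLastEdge_end ha hend h (hlen _ _ h h0)
    have hE := excess_append_singleton τ Turn.R
    rw [if_neg (by decide)] at hE
    have := C.dropLastEdge.abs_excess_sub_one_le (by omega) ha' hend' (by omega)
    have := le_abs_self ((excess τ + 2) / 4 - 1)
    omega
  · have := C.abs_excess_sub_one_le h0 ha hend (by omega)
    have := le_abs_self ((excess σ + 2) / 4 - 1)
    omega
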